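/- Let G be a finitely generated virtually abelian group, Σ a finite subset of G generating G as a monoid, and ω : Σ → ℕ₊ a weight function. For each r ∈ ℕ let c(r) denote the number of conjugacy classes of G that contain an element of weight at most r. Then the conjugacy growth series ∑_{r=0}^∞ c(r) z^r ∈ ℚ[[z]] is a rational function: there exist polynomials p, q ∈ ℚ[z] with q(0) ≠ 0 such that q · (∑_{r=0}^∞ c(r) z^r) = p as formal power series. -/

import Mathlib

open scoped Classical

/-- The weight of a group element induced by a weight function `ω` on a generating set `S`:
`0` for the identity, and otherwise the minimum total weight of a word over `S`
representing the element. -/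
noncomputable def inducedWeight {G : Type*} [Group G] (S : Finset G) (ω : G → ℕ) (g : G) : ℕ :=
  if g = 1 then 0
  else sInf {w : ℕ | ∃ l : List G, (∀ s ∈ l, s ∈ S) ∧ l.prod = g ∧ (l.map ω).sum = w}

/-- A formal power series is rational if it is a quotient of two polynomials, the denominator
having nonzero constant coefficient. -/
def IsRationalSeries (F : PowerSeries ℚ) : Prop :=
  ∃ p q : Polynomial ℚ, q.coeff 0 ≠ 0 ∧ (q : PowerSeries ℚ) * F = (p : PowerSeries ℚ)

namespace IsRationalSeries

variable {F H : PowerSeries ℚ}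

theorem of_polynomial (p : Polynomial ℚ) : IsRationalSeries (p : PowerSeries ℚ) :=
  ⟨p, 1, by simp, by simp⟩

theorem zero : IsRationalSeries 0 := by
  simpa using of_polynomial 0

theorem add (hF : IsRationalSeries F) (hH : IsRationalSeries H) : IsRationalSeries (F + H) := by
  obtain ⟨p, q, hq, h⟩ := hF
  obtain ⟨p', q', hq', h'⟩ := hH
  refine ⟨p * q' + p' * q, q * q', by simp [Polynomial.mul_coeff_zero, hq, hq'], ?_⟩
  push_cast
  rw [← h, ← h']
  ring

theorem mul (hF : IsRationalSeries F) (hH : IsRationalSeries H) : IsRationalSeries (F * H) := by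
  obtain ⟨p, q, hq, h⟩ := hF
  obtain ⟨p', q', hq', h'⟩ := hH
  refine ⟨p * p', q * q', by simp [Polynomial.mul_coeff_zero, hq, hq'], ?_⟩
  push_cast
  rw [← h, ← h']
  ring

theorem sub (hF : IsRationalSeries F) (hH : IsRationalSeries H) : IsRationalSeries (F - H) := by
  simpa [sub_eq_add_neg] using hF.add ((of_polynomial (-1)).mul hH)

theorem X_pow_mul (n : ℕ) (hF : IsRationalSeries F) : IsRationalSeries (PowerSeries.X ^ n * F) := by
  simpa using (of_polynomial (Polynomial.X ^ n)).mul hF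

theorem of_eq_add_X_pow_mul {n : ℕ} (hn : n ≠ 0) (hH : IsRationalSeries H)
    (h : F = H + PowerSeries.X ^ n * F) : IsRationalSeries F := by
  obtain ⟨p, q, hq, hp⟩ := hH
  refine ⟨p, q * (1 - Polynomial.X ^ n), ?_, ?_⟩
  · simp [Polynomial.mul_coeff_zero, hq, Polynomial.coeff_X_pow, hn.symm]
  · have : F - PowerSeries.X ^ n * F = H := by rw [sub_eq_iff_eq_add]; exact h
    rw [← hp, ← this]
    push_cast
    ring

theorem sum {ι : Type*} (s : Finset ι) {f : ι → PowerSeries ℚ}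
    (hf : ∀ i ∈ s, IsRationalSeries (f i)) : IsRationalSeries (∑ i ∈ s, f i) :=
  Finset.sum_induction _ _ (fun _ _ => add) zero hf

end IsRationalSeries

/-- The set `S` has finitely many elements of each degree `d`. -/
def FiniteFibers {α : Type*} (d : α → ℕ) (S : Set α) : Prop :=
  ∀ r, (S ∩ d ⁻¹' {r}).Finite

/-- The generating series counting the elements of `S` by their degree `d`. -/
noncomputable def fiberSeries {α : Type*} (d : α → ℕ) (S : Set α) : PowerSeries ℚ :=
  PowerSeries.mk fun r => ((S ∩ d ⁻¹' {r}).ncard : ℚ)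

section FiberSeries

variable {α β : Type*} {d : α → ℕ} {S T : Set α}

theorem FiniteFibers.mono (hT : FiniteFibers d T) (h : S ⊆ T) : FiniteFibers d S :=
  fun r => (hT r).subset (Set.inter_subset_inter_left _ h)

@[simp]
theorem fiberSeries_empty : fiberSeries d ∅ = 0 := by
  ext r
  simp [fiberSeries]

theorem fiberSeries_union_add_inter (hS : FiniteFibers d S) (hT : FiniteFibers d T) :
    fiberSeries d (S ∪ T) + fiberSeries d (S ∩ T) = fiberSeries d S + fiberSeries d T := by
  ext r
  simp only [fiberSeries, map_add, PowerSeries.coeff_mk, Set.union_inter_distrib_right]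
  rw [Set.inter_inter_distrib_right]
  exact_mod_cast Set.ncard_union_add_ncard_inter _ _ (hS r) (hT r)

theorem fiberSeries_union (hS : FiniteFibers d S) (hT : FiniteFibers d T) (h : Disjoint S T) :
    fiberSeries d (S ∪ T) = fiberSeries d S + fiberSeries d T := by
  rw [← fiberSeries_union_add_inter hS hT, h.inter_eq, fiberSeries_empty, add_zero]

theorem FiniteFibers.of_image {φ : β → α} {d' : β → ℕ} {B : Set β} {c : ℕ} (hφ : Set.InjOn φ B)
    (hd : ∀ x ∈ B, d (φ x) = c + d' x) (h : FiniteFibers d (φ '' B)) : FiniteFibers d' B := by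
  intro r
  refine Set.Finite.of_finite_image ((h (c + r)).subset ?_) (hφ.mono Set.inter_subset_left)
  rintro _ ⟨x, ⟨hx, rfl⟩, rfl⟩
  exact ⟨⟨x, hx, rfl⟩, hd x hx⟩

theorem fiberSeries_image {φ : β → α} {d' : β → ℕ} {B : Set β} {c : ℕ} (hφ : Set.InjOn φ B)
    (hd : ∀ x ∈ B, d (φ x) = c + d' x) :
    fiberSeries d (φ '' B) = PowerSeries.X ^ c * fiberSeries d' B := by
  ext r
  rw [PowerSeries.coeff_X_pow_mul']
  simp only [fiberSeries, PowerSeries.coeff_mk]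
  split_ifs with hr
  · rw [← (hφ.mono Set.inter_subset_left).ncard_image]
    congr 2
    ext y
    constructor
    · rintro ⟨⟨x, hx, rfl⟩, h⟩
      have h' : d (φ x) = r := h
      rw [hd x hx] at h'
      exact ⟨x, ⟨hx, show d' x = r - c by omega⟩, rfl⟩
    · rintro ⟨x, ⟨hx, h⟩, rfl⟩
      have h' : d' x = r - c := h
      exact ⟨⟨x, hx, rfl⟩, show d (φ x) = r by rw [hd x hx]; omega⟩
  · have : φ '' B ∩ d ⁻¹' {r} = ∅ := by
      ext y
      simp only [Set.mem_inter_iff, Set.mem_image, Set.mem_preimage, Set.mem_singleton_iff,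
        Set.mem_empty_iff_false, iff_false, not_and]
      rintro ⟨x, hx, rfl⟩ h
      have := hd x hx
      omega
    simp [this]

theorem IsRationalSeries.fiberSeries_of_finite (hS : S.Finite) :
    IsRationalSeries (fiberSeries d S) := by
  obtain ⟨n, hn⟩ := (hS.image d).bddAbove
  have : fiberSeries d S = ((fiberSeries d S).trunc (n + 1) : Polynomial ℚ) := by
    ext r
    rw [Polynomial.coeff_coe, PowerSeries.coeff_trunc]
    split_ifs with hr
    · rfl
    · have : S ∩ d ⁻¹' {r} = ∅ := by
        ext y
        simp only [Set.mem_inter_iff, Set.mem_preimage, Set.mem_singleton_iff,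
          Set.mem_empty_iff_false, iff_false, not_and]
        rintro hy rfl
        have := hn ⟨y, hy, rfl⟩
        omega
      simp [fiberSeries, this]
  rw [this]
  exact .of_polynomial _

end FiberSeries

theorem IsLowerSet.exists_forall_cons_mem {n : ℕ} {D : Set (Fin (n + 1) → ℕ)} (hD : IsLowerSet D) :
    ∃ K : ℕ, ∀ k ≥ K, ∀ x : Fin n → ℕ,
      (Fin.cons K x : Fin (n + 1) → ℕ) ∈ D → (Fin.cons k x : Fin (n + 1) → ℕ) ∈ D := by
  have hfin : {m | Minimal (· ∈ Dᶜ) m}.Finite :=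
    WellQuasiOrderedLE.finite_of_isAntichain (setOfPred_minimal_antichain _)
  obtain ⟨K, hK⟩ := (hfin.image fun m => m 0).bddAbove
  refine ⟨K, fun k hk x hx => ?_⟩
  by_contra hkx
  obtain ⟨m, hm, hmin⟩ := exists_minimal_le_of_wellFoundedLT (· ∈ Dᶜ) _ hkx
  refine hmin.1 (hD (fun i => ?_) hx)
  cases i using Fin.cases with
  | zero => exact hK ⟨m, hmin, rfl⟩
  | succ i => simpa using hm i.succ

theorem IsLowerSet.isRationalSeries {n : ℕ} {d : (Fin n → ℕ) →+ ℕ} {D : Set (Fin n → ℕ)}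
    (hD : IsLowerSet D) (hfin : FiniteFibers d D) : IsRationalSeries (fiberSeries d D) := by
  induction n with
  | zero => exact .fiberSeries_of_finite (Set.toFinite D)
  | succ n ih =>
    obtain ⟨K, hK⟩ := hD.exists_forall_cons_mem
    let e : Fin (n + 1) → ℕ := Fin.cons 1 0
    let ζ : (Fin n → ℕ) →+ (Fin (n + 1) → ℕ) :=
      { toFun := fun x => Fin.cons 0 x
        map_zero' := by ext i; cases i using Fin.cases <;> rfl
        map_add' := fun x y => by ext i; cases i using Fin.cases <;> simp }
    have hcons (k : ℕ) (x : Fin n → ℕ) : (Fin.cons k x : Fin (n + 1) → ℕ) = k • e + ζ x := by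
      ext i
      cases i using Fin.cases <;> simp [e, ζ]
    let L (k : ℕ) : Set (Fin n → ℕ) := {x | (Fin.cons k x : Fin (n + 1) → ℕ) ∈ D}
    have hinj (k : ℕ) : Set.InjOn (fun x : Fin n → ℕ => (Fin.cons k x : Fin (n + 1) → ℕ)) (L k) :=
      fun x _ y _ h => (Fin.cons_injective2 h).2
    have hsub (k : ℕ) : (fun x => Fin.cons k x) '' L k ⊆ D := by
      rintro _ ⟨x, hx, rfl⟩
      exact hx
    have hdeg (k : ℕ) (x : Fin n → ℕ) :
        d (Fin.cons k x : Fin (n + 1) → ℕ) = k * d e + (d.comp ζ) x := by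
      rw [hcons, map_add, map_nsmul, smul_eq_mul, AddMonoidHom.comp_apply]
    have hslice (k : ℕ) : IsRationalSeries (fiberSeries d ((fun x => Fin.cons k x) '' L k)) := by
      rw [fiberSeries_image (hinj k) fun x _ => hdeg k x]
      refine (ih ?_ ?_).X_pow_mul _
      · intro x y hxy hx
        exact hD (Fin.cons_le_cons.2 ⟨le_rfl, hxy⟩) hx
      · exact FiniteFibers.of_image (hinj k) (fun x _ => hdeg k x) (hfin.mono (hsub k))
    let T (k : ℕ) : Set (Fin (n + 1) → ℕ) := {x ∈ D | k ≤ x 0}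
    have hT (k : ℕ) : fiberSeries d (T k) =
        fiberSeries d ((fun x => Fin.cons k x) '' L k) + fiberSeries d (T (k + 1)) := by
      rw [← fiberSeries_union (hfin.mono (hsub k)) (hfin.mono fun x hx => hx.1)]
      · congr 1
        ext x
        constructor
        · rintro ⟨hx, hk⟩
          rcases hk.eq_or_lt with rfl | hk
          · exact Or.inl ⟨Fin.tail x, by simpa [L] using hx, by simp⟩
          · exact Or.inr ⟨hx, hk⟩
        · rintro (⟨y, hy, rfl⟩ | ⟨hx, hk⟩)
          · exact ⟨hy, by simp⟩
          · exact ⟨hx, by omega⟩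
      · rw [Set.disjoint_left]
        rintro _ ⟨y, hy, rfl⟩ ⟨_, h⟩
        simp at h
    have hTK : IsRationalSeries (fiberSeries d (T K)) := by
      have hshift : T (K + 1) = (fun x => e + x) '' T K := by
        ext x
        constructor
        · rintro ⟨hx, hk⟩
          have hx0 : (Fin.cons (x 0) (Fin.tail x) : Fin (n + 1) → ℕ) = x := by simp
          refine ⟨Fin.cons (x 0 - 1) (Fin.tail x), ⟨hD ?_ hx, ?_⟩, ?_⟩
          · conv_rhs => rw [← hx0]
            exact Fin.cons_le_cons.2 ⟨Nat.sub_le _ _, le_rfl⟩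
          · simp
            omega
          · conv_rhs => rw [← hx0]
            simp only [hcons]
            rw [← add_assoc, ← succ_nsmul']
            congr 3
            omega
        · rintro ⟨y, ⟨hy, hk⟩, rfl⟩
          refine ⟨?_, by simp [e]; omega⟩
          have hy0 : (Fin.cons (y 0) (Fin.tail y) : Fin (n + 1) → ℕ) = y := by simp
          have : (Fin.cons K (Fin.tail y) : Fin (n + 1) → ℕ) ∈ D := by
            refine hD ?_ hy
            conv_rhs => rw [← hy0]
            exact Fin.cons_le_cons.2 ⟨hk, le_rfl⟩
          convert hK (y 0 + 1) (by omega) _ this using 1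
          conv_lhs => rw [← hy0]
          simp only [hcons, succ_nsmul']
          rw [add_assoc]
      have h := hT K
      rw [hshift, fiberSeries_image (d' := d) (c := d e) (fun x _ y _ h => add_left_cancel h)
        (fun x _ => map_add d e x)] at h
      by_cases he : d e = 0
      · suffices T K = ∅ by rw [this, fiberSeries_empty]; exact .zero
        rw [Set.eq_empty_iff_forall_notMem]
        rintro x ⟨hx, hk⟩
        have hmem (j : ℕ) : j • e + x ∈ T K := by
          induction j with
          | zero => simpa using ⟨hx, hk⟩
          | succ j ihj =>
            have : e + (j • e + x) ∈ T (K + 1) := hshift ▸ ⟨_, ihj, rfl⟩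
            rw [← add_assoc, ← succ_nsmul'] at this
            exact ⟨this.1, by have := this.2; omega⟩
        refine Set.infinite_of_injective_forall_mem (f := fun j : ℕ => j • e + x) ?_
          (s := D ∩ d ⁻¹' {d x}) (fun j => ⟨(hmem j).1,
            show d _ = d x by rw [map_add, map_nsmul, he, smul_zero, zero_add]⟩) (hfin _)
        intro i j hij
        simpa [e] using congrFun hij 0
      · exact .of_eq_add_X_pow_mul he (hslice K) h
    have hback (j : ℕ) (hj : j ≤ K) : IsRationalSeries (fiberSeries d (T j)) := by
      induction hj using Nat.decreasingInduction with
      | self => exact hTK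
      | of_succ k hk ihk => rw [hT k]; exact (hslice k).add ihk
    have : T 0 = D := by ext x; simp [T]
    rw [← this]
    exact hback 0 (Nat.zero_le K)

section Solutions

variable {κ M : Type*} [Finite κ] [AddCommMonoid M] [IsCancelAdd M] (F H : (κ → ℕ) →+ M)

theorem AddMonoidHom.eqLocusM_fg : (F.eqLocusM H).FG := by
  have hfin : {m | Minimal (fun z => z ∈ F.eqLocusM H ∧ z ≠ 0) m}.Finite :=
    WellQuasiOrderedLE.finite_of_isAntichain (setOfPred_minimal_antichain _)
  refine (AddSubmonoid.fg_iff _).2 ⟨_, ?_, hfin⟩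
  refine le_antisymm (AddSubmonoid.closure_le.2 fun m hm => hm.1.1) fun z hz => ?_
  induction z using WellFoundedLT.induction with | ind z ih =>
  by_cases hz0 : z = 0
  · rw [hz0]
    exact zero_mem _
  obtain ⟨m, hm, hmin⟩ := exists_minimal_le_of_wellFoundedLT
    (fun z => z ∈ F.eqLocusM H ∧ z ≠ 0) z ⟨hz, hz0⟩
  obtain ⟨y, rfl⟩ := exists_add_of_le hm
  refine add_mem (AddSubmonoid.subset_closure hmin) (ih y ?_ ?_)
  · exact lt_add_of_pos_left y (pos_iff_ne_zero.2 hmin.1.2)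
  · have h1 : F m = H m := hmin.1.1
    have h2 : F (m + y) = H (m + y) := hz
    rw [map_add, map_add, h1] at h2
    exact add_left_cancel h2

theorem AddMonoidHom.exists_finset_add_eq_iff (a b : M) : ∃ E : Finset (κ → ℕ),
    ∀ z, a + F z = b + H z ↔ ∃ e ∈ E, ∃ y ∈ F.eqLocusM H, e + y = z := by
  have hfin : {m | Minimal (fun z => a + F z = b + H z) m}.Finite :=
    WellQuasiOrderedLE.finite_of_isAntichain (setOfPred_minimal_antichain _)
  refine ⟨hfin.toFinset, fun z => ⟨fun hz => ?_, ?_⟩⟩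
  · obtain ⟨m, hm, hmin⟩ := exists_minimal_le_of_wellFoundedLT (fun z => a + F z = b + H z) z hz
    obtain ⟨y, rfl⟩ := exists_add_of_le hm
    refine ⟨m, by simpa using hmin, y, ?_, rfl⟩
    have h1 : a + F m = b + H m := hmin.1
    rw [map_add, map_add, ← add_assoc, ← add_assoc, h1] at hz
    exact add_left_cancel hz
  · rintro ⟨e, he, y, hy, rfl⟩
    have h1 : a + F e = b + H e := (hfin.mem_toFinset.1 he).1
    have h2 : F y = H y := hy
    rw [map_add, map_add, ← add_assoc, ← add_assoc, h1, h2]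

end Solutions

/-- A set is a finite union of cosets of a single finitely generated submonoid. -/
def IsFiniteUnionOfCosets {M : Type*} [AddCommMonoid M] (S : Set M) : Prop :=
  ∃ (E : Finset M) (P : AddSubmonoid M), P.FG ∧ ∀ x, x ∈ S ↔ ∃ e ∈ E, ∃ y ∈ P, e + y = x

section Cosets

variable {M : Type*} [AddCommMonoid M]

theorem IsLinearSet.isFiniteUnionOfCosets {S : Set M} (hS : IsLinearSet S) :
    IsFiniteUnionOfCosets S := by
  obtain ⟨a, P, hP, rfl⟩ := isLinearSet_iff_exists_fg_eq_vadd.1 hS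
  exact ⟨{a}, P, hP, fun x => by simp [Set.mem_vadd_set]⟩

variable [IsCancelAdd M]

theorem IsFiniteUnionOfCosets.inter {S T : Set M} (hS : IsFiniteUnionOfCosets S)
    (hT : IsFiniteUnionOfCosets T) : IsFiniteUnionOfCosets (S ∩ T) := by
  obtain ⟨E, P, hP, hS⟩ := hS
  obtain ⟨E', P', hP', hT⟩ := hT
  obtain ⟨n, f, hf⟩ := AddSubmonoid.fg_iff_exists_fin_addMonoidHom.1 hP
  obtain ⟨m, g, hg⟩ := AddSubmonoid.fg_iff_exists_fin_addMonoidHom.1 hP'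
  let F : (Fin n ⊕ Fin m → ℕ) →+ M := f.comp (LinearMap.funLeft ℕ ℕ Sum.inl).toAddMonoidHom
  let H : (Fin n ⊕ Fin m → ℕ) →+ M := g.comp (LinearMap.funLeft ℕ ℕ Sum.inr).toAddMonoidHom
  choose Z hZ using fun p : M × M => F.exists_finset_add_eq_iff H p.1 p.2
  refine ⟨(E ×ˢ E').biUnion fun p => (Z p).image fun z => p.1 + F z,
    (F.eqLocusM H).map F, (F.eqLocusM_fg H).map F, fun x => ?_⟩
  constructor
  · rintro ⟨hxS, hxT⟩
    obtain ⟨e, he, y, hy, rfl⟩ := (hS x).1 hxS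
    obtain ⟨e', he', y', hy', hyy⟩ := (hT _).1 hxT
    rw [← hf] at hy
    rw [← hg] at hy'
    obtain ⟨u, rfl⟩ := hy
    obtain ⟨v, rfl⟩ := hy'
    have hu : F (Sum.elim u v) = f u := rfl
    have hv : H (Sum.elim u v) = g v := rfl
    obtain ⟨z, hz, w, hw, hzw⟩ := (hZ (e, e') (Sum.elim u v)).1 (by rw [hu, hv]; exact hyy.symm)
    refine ⟨e + F z, ?_, F w, ⟨w, hw, rfl⟩, ?_⟩
    · rw [Finset.mem_biUnion]
      exact ⟨(e, e'), Finset.mk_mem_product he he', Finset.mem_image_of_mem _ hz⟩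
    · rw [add_assoc, ← map_add, hzw, hu]
  · rintro ⟨_, hx, _, ⟨w, hw, rfl⟩, rfl⟩
    rw [Finset.mem_biUnion] at hx
    obtain ⟨⟨e, e'⟩, he, hx⟩ := hx
    obtain ⟨z, hz, rfl⟩ := Finset.mem_image.1 hx
    rw [Finset.mem_product] at he
    have h := (hZ (e, e') (z + w)).2 ⟨z, hz, w, hw, rfl⟩
    simp only [add_assoc, ← map_add]
    refine ⟨(hS _).2 ⟨e, he.1, F (z + w), ?_, rfl⟩, (hT _).2 ⟨e', he.2, H (z + w), ?_, h.symm⟩⟩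
    · rw [← hf]
      exact ⟨_, rfl⟩
    · rw [← hg]
      exact ⟨_, rfl⟩

theorem IsFiniteUnionOfCosets.isRationalSeries {S : Set M} (hS : IsFiniteUnionOfCosets S)
    {d : M →+ ℕ} (hfin : FiniteFibers d S) : IsRationalSeries (fiberSeries d S) := by
  obtain ⟨E, P, hP, hS⟩ := hS
  obtain ⟨n, f, rfl⟩ := AddSubmonoid.fg_iff_exists_fin_addMonoidHom.1 hP
  induction E using Finset.induction_on generalizing S with
  | empty =>
    have : S = ∅ := by ext x; simp [hS]
    rw [this, fiberSeries_empty]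
    exact .zero
  | insert a E ha ih =>
    let T : Set M := {x | ∃ e ∈ E, ∃ y ∈ AddMonoidHom.mrange f, e + y = x}
    have hTS : T ⊆ S := by
      rintro x ⟨e, he, h⟩
      exact (hS x).2 ⟨e, Finset.mem_insert_of_mem he, h⟩
    let D : Set (Fin n → ℕ) := {x | a + f x ∉ T ∧ ∀ y, toLex y < toLex x → f y ≠ f x}
    have hD : IsLowerSet D := by
      rintro x y hxy ⟨hx, hx'⟩
      obtain ⟨z, rfl⟩ := exists_add_of_le hxy
      constructor
      · rintro ⟨e, he, _, ⟨u, rfl⟩, h⟩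
        exact hx ⟨e, he, _, ⟨u + z, rfl⟩, by rw [map_add, ← add_assoc, h, map_add, add_assoc]⟩
      · intro u hu h
        exact hx' (u + z) (by simpa using hu) (by rw [map_add, map_add, h])
    have hinj : Set.InjOn (fun x => a + f x) D := by
      intro x hx y hy h
      have h : f x = f y := add_left_cancel h
      rcases lt_trichotomy (toLex x) (toLex y) with hlt | heq | hlt
      · exact absurd h (hy.2 x hlt)
      · exact toLex.injective heq
      · exact absurd h.symm (hx.2 y hlt)
    have hunion : S = T ∪ (fun x => a + f x) '' D := by
      ext x
      constructor
      · intro hx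
        by_cases hxT : x ∈ T
        · exact Or.inl hxT
        obtain ⟨e, he, _, ⟨u, rfl⟩, rfl⟩ := (hS x).1 hx
        rcases Finset.mem_insert.1 he with rfl | he
        · have hne : {v : Lex (Fin n → ℕ) | f (ofLex v) = f u}.Nonempty := ⟨toLex u, rfl⟩
          let v := WellFounded.min (wellFounded_lt (α := Lex (Fin n → ℕ))) _ hne
          have hv : f (ofLex v) = f u := WellFounded.min_mem _ _ hne
          refine Or.inr ⟨ofLex v, ⟨by rwa [hv], fun y hy h => ?_⟩, by simp [hv]⟩
          exact WellFounded.not_lt_min wellFounded_lt _ (x := toLex y) (h.trans hv) hy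
        · exact absurd ⟨e, he, _, ⟨u, rfl⟩, rfl⟩ hxT
      · rintro (hx | ⟨u, -, rfl⟩)
        · exact hTS hx
        · exact (hS _).2 ⟨a, Finset.mem_insert_self _ _, _, ⟨u, rfl⟩, rfl⟩
    have hDS : (fun x => a + f x) '' D ⊆ S := hunion ▸ Set.subset_union_right
    have hdeg : ∀ x ∈ D, d (a + f x) = d a + (d.comp f) x := fun x _ => by simp
    rw [hunion, fiberSeries_union (hfin.mono hTS) (hfin.mono hDS)]
    · refine (ih (hfin.mono hTS) (fun x => Iff.rfl)).add ?_
      rw [fiberSeries_image hinj hdeg]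
      exact (hD.isRationalSeries (.of_image hinj hdeg (hfin.mono hDS))).X_pow_mul _
    · rw [Set.disjoint_right]
      rintro _ ⟨x, hx, rfl⟩
      exact hx.1

theorem IsRationalSeries.fiberSeries_biUnion {d : M →+ ℕ} {ι : Type*} (I : Finset ι)
    (A : ι → Set M) (hA : ∀ i ∈ I, IsFiniteUnionOfCosets (A i))
    (hfin : ∀ i ∈ I, FiniteFibers d (A i)) :
    IsRationalSeries (fiberSeries d (⋃ i ∈ I, A i)) := by
  induction I using Finset.induction_on generalizing A with
  | empty => simpa using IsRationalSeries.zero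
  | insert i I hi ih =>
    simp only [Finset.mem_insert, forall_eq_or_imp] at hA hfin
    have hfinI : FiniteFibers d (⋃ j ∈ I, A j) := by
      intro r
      simp only [Set.iUnion_inter]
      exact I.finite_toSet.biUnion fun j hj => hfin.2 j hj r
    rw [Finset.set_biUnion_insert,
      eq_sub_of_add_eq (fiberSeries_union_add_inter hfin.1 hfinI)]
    refine ((hA.1.isRationalSeries hfin.1).add (ih A hA.2 hfin.2)).sub ?_
    simp only [Set.inter_iUnion]
    exact ih _ (fun j hj => hA.1.inter (hA.2 j hj))
      fun j hj => hfin.1.mono Set.inter_subset_left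

theorem IsSemilinearSet.isRationalSeries {S : Set M} (hS : IsSemilinearSet S) {d : M →+ ℕ}
    (hfin : FiniteFibers d S) : IsRationalSeries (fiberSeries d S) := by
  obtain ⟨I, hI, rfl⟩ := isSemilinearSet_iff.1 hS
  rw [Set.sUnion_eq_biUnion]
  exact .fiberSeries_biUnion I id (fun A hA => (hI A hA).isFiniteUnionOfCosets)
    fun A hA => hfin.mono (Set.subset_sUnion_of_mem hA)

end Cosets

section Automata

variable {σ M : Type*} [AddCommMonoid M]

/-- `LabelledPath e U p q m` says that `m` is the sum of the labels along a nonempty path from `p`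
to `q` in the graph with edge labels `e`, all of whose intermediate vertices lie in `U`. -/
inductive LabelledPath (e : σ → σ → Set M) (U : Set σ) : σ → σ → M → Prop
  | edge {p q m} : m ∈ e p q → LabelledPath e U p q m
  | cons {p u q m m'} : m ∈ e p u → u ∈ U → LabelledPath e U u q m' →
      LabelledPath e U p q (m + m')

namespace LabelledPath

variable {e : σ → σ → Set M} {U U' : Set σ} {p u q : σ} {m m' : M}

theorem mono (h : U ⊆ U') (hm : LabelledPath e U p q m) : LabelledPath e U' p q m := by
  induction hm with
  | edge hm => exact .edge hm
  | cons hm hu _ ih => exact .cons hm (h hu) ih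

theorem append (hu : u ∈ U) (hm : LabelledPath e U p u m) (hm' : LabelledPath e U u q m') :
    LabelledPath e U p q (m + m') := by
  induction hm with
  | edge hm => exact .cons hm hu hm'
  | cons hm hv _ ih =>
    rw [add_assoc]
    exact .cons hm hv (ih hu hm')

open Pointwise in
theorem setOf_insert (u : σ) (U : Set σ) (p q : σ) :
    {m | LabelledPath e (insert u U) p q m} = {m | LabelledPath e U p q m} ∪
      ({m | LabelledPath e U p u m} +
        ((AddSubmonoid.closure {m | LabelledPath e U u u m} : Set M) +
          {m | LabelledPath e U u q m})) := by
  ext m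
  constructor
  · intro h
    induction h with
    | edge hm => exact Or.inl (.edge hm)
    | @cons p v q m m' hm hv _ ih =>
      rcases hv with rfl | hv
      · refine Or.inr ⟨m, .edge hm, m', ?_, rfl⟩
        rcases ih with ih | ⟨x, hx, _, ⟨y, hy, z, hz, rfl⟩, rfl⟩
        · exact ⟨0, zero_mem _, m', ih, zero_add _⟩
        · exact ⟨x + y, add_mem (AddSubmonoid.subset_closure hx) hy, z, hz, add_assoc _ _ _⟩
      · rcases ih with ih | ⟨x, hx, y, hy, rfl⟩
        · exact Or.inl (.cons hm hv ih)
        · exact Or.inr ⟨m + x, .cons hm hv hx, y, hy, add_assoc _ _ _⟩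
  · have hU : U ⊆ insert u U := Set.subset_insert _ _
    have hu : u ∈ insert u U := Set.mem_insert _ _
    rintro (h | ⟨x, hx, _, ⟨y, hy, z, hz, rfl⟩, rfl⟩)
    · exact mono hU h
    · refine append hu (mono hU hx) ?_
      induction hy using AddSubmonoid.closure_induction_left with
      | zero => simpa using mono hU hz
      | add_left a ha b _ ih =>
        change LabelledPath e (insert u U) u q (a + b + z)
        rw [add_assoc]
        exact append hu (mono hU ha) ih

theorem isSemilinearSet [Finite σ] (he : ∀ p q, IsSemilinearSet (e p q)) (U : Set σ) (p q : σ) :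
    IsSemilinearSet {m | LabelledPath e U p q m} := by
  induction U, U.toFinite using Set.Finite.induction_on generalizing p q with
  | empty =>
    convert he p q using 1
    ext m
    refine ⟨fun h => ?_, .edge⟩
    cases h with
    | edge h => exact h
    | cons _ h _ => exact h.elim
  | insert _ _ ih =>
    rw [setOf_insert]
    exact (ih _ _).union ((ih _ _).add ((ih _ _).closure.add (ih _ _)))

end LabelledPath

end Automata

theorem isSemilinearSet_setOf_lt : IsSemilinearSet {p : ℕ × ℕ | p.1 < p.2} := by
  have h := isSemilinearSet_setOfPred_eq (M := (ℕ × ℕ) × ℕ) (N := ℕ) 1 0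
    ((AddMonoidHom.fst ℕ ℕ).comp (AddMonoidHom.fst _ ℕ) + AddMonoidHom.snd _ ℕ)
    ((AddMonoidHom.snd ℕ ℕ).comp (AddMonoidHom.fst _ ℕ))
  convert h.image (AddMonoidHom.fst (ℕ × ℕ) ℕ) using 1
  ext ⟨a, b⟩
  constructor
  · intro hab
    have hab : a < b := hab
    exact ⟨((a, b), b - a - 1), show 1 + (a + (b - a - 1)) = 0 + b by omega, rfl⟩
  · rintro ⟨⟨⟨a', b'⟩, c⟩, h, heq⟩
    have h : 1 + (a' + c) = 0 + b' := h
    obtain ⟨rfl, rfl⟩ := Prod.mk.inj heq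
    show a' < b'
    omega

theorem isSemilinearSet_setOf_toLex_lt (n : ℕ) :
    IsSemilinearSet {p : (Fin n → ℕ) × (Fin n → ℕ) | toLex p.2 < toLex p.1} := by
  let π (i : Fin n) : (Fin n → ℕ) →+ ℕ := Pi.evalAddMonoidHom _ i
  have : {p : (Fin n → ℕ) × (Fin n → ℕ) | toLex p.2 < toLex p.1} =
      ⋃ i, ((⋂ j ∈ {j | j < i}, {p : (Fin n → ℕ) × (Fin n → ℕ) | 0 + π j p.2 = 0 + π j p.1}) ∩
        ((((π i).comp (AddMonoidHom.snd _ _)).prod ((π i).comp (AddMonoidHom.fst _ _))) ⁻¹'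
          {p : ℕ × ℕ | p.1 < p.2})) := by
    ext p
    simp only [Set.mem_iUnion, Set.mem_inter_iff, Set.mem_iInter]
    exact exists_congr fun i => and_congr
      (forall₂_congr fun j _ => by simp [π]) Iff.rfl
  rw [this]
  refine .iUnion fun i => .inter (.biInter (Set.toFinite _) fun j _ => ?_)
    (isSemilinearSet_setOf_lt.preimage _)
  exact isSemilinearSet_setOfPred_eq 0 0 ((π j).comp (AddMonoidHom.snd _ _))
    ((π j).comp (AddMonoidHom.fst _ _))

theorem inducedWeight_le_iff {G : Type*} [Group G] {S : Finset G}
    (hgen : ∀ g : G, ∃ l : List G, (∀ s ∈ l, s ∈ S) ∧ l.prod = g) (ω : G → ℕ) (g : G) (r : ℕ) :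
    inducedWeight S ω g ≤ r ↔
      ∃ l : List G, (∀ s ∈ l, s ∈ S) ∧ l.prod = g ∧ (l.map ω).sum ≤ r := by
  unfold inducedWeight
  split_ifs with hg
  · exact iff_of_true (Nat.zero_le r) ⟨[], by simp, by simp [hg], by simp⟩
  · constructor
    · intro h
      obtain ⟨l, hl, hlg⟩ := hgen g
      obtain ⟨l', hl', hl'g, hw⟩ := Nat.sInf_mem (s := {w : ℕ | ∃ l : List G, (∀ s ∈ l, s ∈ S) ∧
        l.prod = g ∧ (l.map ω).sum = w}) ⟨_, l, hl, hlg, rfl⟩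
      exact ⟨l', hl', hl'g, hw.trans_le h⟩
    · rintro ⟨l, hl, hlg, hw⟩
      exact le_trans (Nat.sInf_le ⟨l, hl, hlg, rfl⟩) hw

/-- A decomposition of a group `G` into the cosets of a normal subgroup isomorphic to the additive
abelian group `V`, with coset representatives indexed by `σ`. -/
structure AbelianByFinite (G V σ : Type*) [Group G] [AddCommGroup V] where
  /-- The embedding of the abelian group. -/
  incl : V → G
  /-- The coset representatives. -/
  rep : σ → G
  /-- The action of the group on the normal subgroup by conjugation. -/
  conj : G → V →+ V
  /-- The part of an element in the normal subgroup. -/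
  coord : G → V
  /-- The index of the coset of an element. -/
  index : G → σ
  incl_add : ∀ a b, incl (a + b) = incl a * incl b
  incl_conj : ∀ g a, incl (conj g a) = g * incl a * g⁻¹
  incl_coord_mul_rep : ∀ g, incl (coord g) * rep (index g) = g
  incl_mul_rep_inj : ∀ a i b k, incl a * rep i = incl b * rep k → a = b ∧ i = k

namespace AbelianByFinite

variable {G V σ : Type*} [Group G] [AddCommGroup V] (D : AbelianByFinite G V σ)

open scoped IsMulCommutative in
/-- The decomposition associated with an abelian normal subgroup, with coset representatives
indexed by a type equivalent to the quotient. -/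
noncomputable def ofSubgroup (A : Subgroup G) [A.Normal] [IsMulCommutative A]
    (ε : σ ≃ G ⧸ A) : AbelianByFinite G (Additive A) σ :=
  have mem (g : G) : g * (ε.symm (g : G ⧸ A) |> ε).out⁻¹ ∈ A := by
    rw [Equiv.apply_symm_apply, ← QuotientGroup.eq_one_iff]
    simp
  { incl := fun a => (a.toMul : G)
    rep := fun i => (ε i).out
    conj := fun g => MonoidHom.toAdditive (MulAut.conjNormal g : A ≃* A).toMonoidHom
    coord := fun g => Additive.ofMul (⟨_, mem g⟩ : A)
    index := fun g => ε.symm g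
    incl_add := fun a b => rfl
    incl_conj := fun g a => by
      exact MulAut.conjNormal_apply g a.toMul
    incl_coord_mul_rep := fun g => by simp
    incl_mul_rep_inj := fun a i b k h => by
      have hi : i = k := by
        have h' := congrArg (QuotientGroup.mk (s := A)) h
        have ha (c : Additive A) : ((c.toMul : G) : G ⧸ A) = 1 :=
          (QuotientGroup.eq_one_iff _).2 c.toMul.2
        simpa [ha] using h'
      subst hi
      exact ⟨Additive.toMul.injective (Subtype.ext (mul_right_cancel h)), rfl⟩ }

theorem incl_zero : D.incl 0 = 1 := by
  simpa using D.incl_add 0 0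

theorem incl_mul_rep_eq_iff (a : V) (i : σ) (g : G) :
    D.incl a * D.rep i = g ↔ a = D.coord g ∧ i = D.index g := by
  constructor
  · intro h
    exact D.incl_mul_rep_inj _ _ _ _ (h.trans (D.incl_coord_mul_rep g).symm)
  · rintro ⟨rfl, rfl⟩
    exact D.incl_coord_mul_rep g

section Words

variable (S : Finset G) (ω : G → ℕ)

/-- The labels of the edges of the Schreier graph of the cosets with respect to `S`, recording the
change in the abelian subgroup and the weight of the generator. -/
def edges (i k : σ) : Set (V × ℕ) :=
  {m | ∃ s ∈ S, D.rep i * s = D.incl m.1 * D.rep k ∧ ω s = m.2}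

theorem isSemilinearSet_edges (i k : σ) : IsSemilinearSet (D.edges S ω i k) := by
  refine .of_finite ((S.finite_toSet.image fun s => (D.coord (D.rep i * s), ω s)).subset ?_)
  rintro ⟨a, w⟩ ⟨s, hs, h, hw⟩
  exact ⟨s, hs, Prod.ext ((D.incl_mul_rep_eq_iff _ _ _).1 h.symm).1.symm hw⟩

theorem exists_word_iff (i k : σ) (m : V × ℕ) :
    (∃ l : List G, (∀ s ∈ l, s ∈ S) ∧ D.rep i * l.prod = D.incl m.1 * D.rep k ∧
      (l.map ω).sum = m.2) ↔
    LabelledPath (D.edges S ω) Set.univ i k m ∨ i = k ∧ m = 0 := by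
  constructor
  · rintro ⟨l, hl, hprod, hsum⟩
    induction l generalizing i m with
    | nil =>
      right
      have h : D.incl 0 * D.rep i = D.incl m.1 * D.rep k := by simpa [D.incl_zero] using hprod
      obtain ⟨h1, h2⟩ := D.incl_mul_rep_inj _ _ _ _ h
      exact ⟨h2, Prod.ext h1.symm (by simpa using hsum.symm)⟩
    | cons s l ih =>
      left
      simp only [List.mem_cons, forall_eq_or_imp] at hl
      let g := D.rep i * s
      have hg : g = D.incl (D.coord g) * D.rep (D.index g) := (D.incl_coord_mul_rep g).symm
      have hedge : (D.coord g, ω s) ∈ D.edges S ω i (D.index g) := ⟨s, hl.1, hg, rfl⟩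
      have hm : m = (D.coord g, ω s) + (m.1 - D.coord g, (l.map ω).sum) :=
        Prod.ext (by simp) (by simpa using hsum.symm)
      have hrest : D.rep (D.index g) * l.prod = D.incl (m.1 - D.coord g) * D.rep k := by
        rw [← mul_right_inj (D.incl (D.coord g)), ← mul_assoc, ← hg, ← mul_assoc, ← D.incl_add,
          add_sub_cancel, ← hprod, List.prod_cons, mul_assoc]
      rcases ih (D.index g) (m.1 - D.coord g, (l.map ω).sum) hl.2 hrest rfl with h | ⟨h1, h2⟩
      · rw [hm]
        exact .cons hedge trivial h
      · rw [hm, h2, add_zero, ← h1]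
        exact .edge hedge
  · rintro (h | ⟨rfl, rfl⟩)
    · induction h with
      | edge h =>
        obtain ⟨s, hs, h, hw⟩ := h
        exact ⟨[s], by simpa using hs, by simpa using h, by simpa using hw⟩
      | cons h _ _ ih =>
        obtain ⟨s, hs, h, hw⟩ := h
        obtain ⟨l, hl, hprod, hsum⟩ := ih
        refine ⟨s :: l, by simpa using ⟨hs, hl⟩, ?_, by simp [hw, hsum]⟩
        rw [List.prod_cons, ← mul_assoc, h, mul_assoc, hprod, ← mul_assoc, Prod.fst_add,
          D.incl_add]
    · exact ⟨[], by simp, by simp [D.incl_zero], by simp⟩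

open Pointwise in
theorem isSemilinearSet_weight_le [Finite σ]
    (hgen : ∀ g : G, ∃ l : List G, (∀ s ∈ l, s ∈ S) ∧ l.prod = g) (k : σ) :
    IsSemilinearSet {m : V × ℕ | inducedWeight S ω (D.incl m.1 * D.rep k) ≤ m.2} := by
  have hpath : IsSemilinearSet {m : V × ℕ |
      LabelledPath (D.edges S ω) Set.univ (D.index 1) k m ∨ D.index 1 = k ∧ m = 0} := by
    refine (LabelledPath.isSemilinearSet (D.isSemilinearSet_edges S ω) _ _ _).union ?_
    exact .of_finite ((Set.finite_singleton 0).subset fun m hm => hm.2)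
  have hone : D.incl (D.coord 1) * D.rep (D.index 1) = 1 := D.incl_coord_mul_rep 1
  convert (IsSemilinearSet.singleton (D.coord 1, 0)).add
    (hpath.add (IsSemilinearSet.closure_finset {((0, 1) : V × ℕ)})) using 1
  have hmul (a : V) (l : List G) : l.prod = D.incl (D.coord 1 + a) * D.rep k ↔
      D.rep (D.index 1) * l.prod = D.incl a * D.rep k := by
    rw [← mul_right_inj (D.incl (D.coord 1)) (b := D.rep (D.index 1) * l.prod), ← mul_assoc, hone,
      one_mul, D.incl_add, mul_assoc]
  ext m
  simp only [Set.mem_ofPred_eq, inducedWeight_le_iff hgen, ← D.exists_word_iff S ω]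
  constructor
  · rintro ⟨l, hl, hprod, hsum⟩
    refine ⟨_, rfl, _, ⟨(m.1 - D.coord 1, (l.map ω).sum), ⟨l, hl, ?_, rfl⟩,
      (m.2 - (l.map ω).sum) • (0, 1), ?_, rfl⟩, ?_⟩
    · rw [← hmul, hprod, add_sub_cancel]
    · exact nsmul_mem (AddSubmonoid.subset_closure (by simp)) _
    · refine Prod.ext (by simp) ?_
      simp
      omega
  · rintro ⟨_, rfl, _, ⟨x, ⟨l, hl, hprod, hsum⟩, y, hy, rfl⟩, rfl⟩
    simp only [Finset.coe_singleton, SetLike.mem_coe, AddSubmonoid.mem_closure_singleton] at hy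
    obtain ⟨n, rfl⟩ := hy
    refine ⟨l, hl, ?_, ?_⟩
    · rw [← hmul] at hprod
      simpa using hprod
    · simp [hsum]

end Words

section Representatives

variable {n : ℕ} (f : (Fin n → ℕ) →+ V)

/-- The group element with natural number coordinates `x` in the coset indexed by `i`. -/
def elt (i : σ) (x : Fin n → ℕ) : G :=
  D.incl (f x) * D.rep i

theorem exists_elt_eq (hf : Function.Surjective f) (g : G) : ∃ i x, D.elt f i x = g := by
  obtain ⟨x, hx⟩ := hf (D.coord g)
  exact ⟨D.index g, x, by rw [elt, hx, D.incl_coord_mul_rep]⟩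

theorem conj_incl_mul_rep_eq_iff (l i k : σ) (a b c : V) :
    (D.incl c * D.rep l) * (D.incl a * D.rep i) * (D.incl c * D.rep l)⁻¹ = D.incl b * D.rep k ↔
      D.index (D.rep l * D.rep i * (D.rep l)⁻¹) = k ∧
        b + D.conj (D.rep k) c =
          D.coord (D.rep l * D.rep i * (D.rep l)⁻¹) + (c + D.conj (D.rep l) a) := by
  set g := D.rep l * D.rep i * (D.rep l)⁻¹ with hg
  have h1 : (D.incl c * D.rep l) * (D.incl a * D.rep i) * (D.incl c * D.rep l)⁻¹ =
      D.incl (D.coord g + (c + D.conj (D.rep l) a)) * D.rep (D.index g) * (D.incl c)⁻¹ := by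
    rw [add_comm, D.incl_add, mul_assoc (D.incl _) (D.incl _), D.incl_coord_mul_rep, D.incl_add,
      D.incl_conj, hg]
    group
  have h2 : D.incl b * D.rep k * D.incl c = D.incl (b + D.conj (D.rep k) c) * D.rep k := by
    rw [D.incl_add, D.incl_conj]
    group
  rw [h1, mul_inv_eq_iff_eq_mul, h2]
  constructor
  · intro h
    have := D.incl_mul_rep_inj _ _ _ _ h
    exact ⟨this.2, this.1.symm⟩
  · rintro ⟨rfl, h⟩
    rw [h]

theorem isSemilinearSet_isConj [Finite σ] [AddMonoid.FG V] (i k : σ) :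
    IsSemilinearSet {p : (Fin n → ℕ) × (Fin n → ℕ) | IsConj (D.elt f i p.1) (D.elt f k p.2)} := by
  let F (l : σ) : Set (((Fin n → ℕ) × (Fin n → ℕ)) × V) :=
    {q | D.index (D.rep l * D.rep i * (D.rep l)⁻¹) = k ∧ f q.1.2 + D.conj (D.rep k) q.2 =
      D.coord (D.rep l * D.rep i * (D.rep l)⁻¹) + (q.2 + D.conj (D.rep l) (f q.1.1))}
  have hF (l : σ) : IsSemilinearSet (F l) := by
    by_cases hl : D.index (D.rep l * D.rep i * (D.rep l)⁻¹) = k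
    · convert isSemilinearSet_setOfPred_eq (M := ((Fin n → ℕ) × (Fin n → ℕ)) × V) 0
        (D.coord (D.rep l * D.rep i * (D.rep l)⁻¹))
        ((f.comp ((AddMonoidHom.snd _ _).comp (AddMonoidHom.fst _ _))) +
          (D.conj (D.rep k)).comp (AddMonoidHom.snd _ _))
        (AddMonoidHom.snd _ _ + (D.conj (D.rep l)).comp
          (f.comp ((AddMonoidHom.fst _ _).comp (AddMonoidHom.fst _ _)))) using 1
      ext q
      simp [F, hl]
    · simp [F, hl]
  convert IsSemilinearSet.iUnion fun l => (hF l).image (AddMonoidHom.fst _ V) using 1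
  ext ⟨x, y⟩
  simp only [isConj_iff, Set.mem_ofPred_eq, Set.mem_iUnion]
  constructor
  · rintro ⟨g, hg⟩
    rw [← D.incl_coord_mul_rep g, elt, elt, conj_incl_mul_rep_eq_iff] at hg
    exact ⟨D.index g, ((x, y), D.coord g), hg, rfl⟩
  · rintro ⟨l, ⟨⟨x, y⟩, c⟩, h, ⟨⟩⟩
    exact ⟨D.incl c * D.rep l, (D.conj_incl_mul_rep_eq_iff _ _ _ _ _ _).2 h⟩

variable [LinearOrder σ]

/-- The coordinates of the elements in the coset indexed by `i` which are minimal in their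
conjugacy class with respect to the lexicographic order. -/
def minimalReps (i : σ) : Set (Fin n → ℕ) :=
  {x | (∀ k < i, ∀ y, ¬ IsConj (D.elt f i x) (D.elt f k y)) ∧
    ∀ y, toLex y < toLex x → ¬ IsConj (D.elt f i x) (D.elt f i y)}

theorem isSemilinearSet_minimalReps [Finite σ] [AddMonoid.FG V] (i : σ) :
    IsSemilinearSet (D.minimalReps f i) := by
  let π := AddMonoidHom.fst (Fin n → ℕ) (Fin n → ℕ)
  have h := (IsSemilinearSet.biInter (Set.toFinite {k | k < i}) fun k _ =>
    ((D.isSemilinearSet_isConj f i k).image π).compl).inter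
      (((D.isSemilinearSet_isConj f i i).inter (isSemilinearSet_setOf_toLex_lt n)).image π).compl
  convert h using 1
  ext x
  simp only [minimalReps, Set.mem_ofPred_eq, Set.mem_inter_iff, Set.mem_iInter, Set.mem_compl_iff,
    Set.mem_image, Prod.exists, not_exists, not_and]
  constructor
  · rintro ⟨h1, h2⟩
    refine ⟨fun k hk _ y hc hx => ?_, fun _ y hc hx => ?_⟩ <;> obtain rfl : _ = x := hx
    · exact h1 k hk y hc
    · exact h2 y hc.2 hc.1
  · rintro ⟨h1, h2⟩
    exact ⟨fun k hk y hc => h1 k hk x y hc rfl, fun y hy hc => h2 x y ⟨hc, hy⟩ rfl⟩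

theorem exists_mem_minimalReps [Finite σ] (hf : Function.Surjective f) (g : G) :
    ∃ i, ∃ x ∈ D.minimalReps f i, IsConj g (D.elt f i x) := by
  obtain ⟨i, ⟨x, hx⟩, hi⟩ := exists_minimal_of_wellFoundedLT
    (fun i => ∃ x, IsConj g (D.elt f i x)) (by
      obtain ⟨i, x, h⟩ := D.exists_elt_eq f hf g
      exact ⟨i, x, h ▸ IsConj.refl _⟩)
  obtain ⟨y, hy, hmin⟩ := exists_minimal_of_wellFoundedLT
    (fun y : Lex (Fin n → ℕ) => IsConj g (D.elt f i (ofLex y))) ⟨toLex x, hx⟩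
  refine ⟨i, ofLex y, ⟨fun k hk z hz => ?_, fun z hz hc => ?_⟩, hy⟩
  · exact (hi ⟨z, hy.trans hz⟩ hk.le).not_gt hk
  · exact (hmin (y := toLex z) (hy.trans hc) hz.le).not_gt hz

theorem eq_of_isConj_of_mem_minimalReps {i k : σ} {x y : Fin n → ℕ} (hx : x ∈ D.minimalReps f i)
    (hy : y ∈ D.minimalReps f k) (h : IsConj (D.elt f i x) (D.elt f k y)) : i = k ∧ x = y := by
  rcases lt_trichotomy i k with hik | rfl | hik
  · exact (hy.1 i hik x h.symm).elim
  · refine ⟨rfl, ?_⟩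
    rcases lt_trichotomy (toLex x) (toLex y) with hxy | hxy | hxy
    · exact (hy.2 x hxy h.symm).elim
    · exact hxy
    · exact (hx.2 y hxy h).elim
  · exact (hx.1 k hik y h).elim

variable (S : Finset G) (ω : G → ℕ)

/-- The minimal representatives in the coset indexed by `i` of conjugacy classes containing an
element of weight at most `r`, together with `r`. -/
def weightedReps (i : σ) : Set ((Fin n → ℕ) × ℕ) :=
  {p | p.1 ∈ D.minimalReps f i ∧ ∃ g, IsConj (D.elt f i p.1) g ∧ inducedWeight S ω g ≤ p.2}

theorem isSemilinearSet_weightedReps [Finite σ] [AddMonoid.FG V] (hf : Function.Surjective f)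
    (hgen : ∀ g : G, ∃ l : List G, (∀ s ∈ l, s ∈ S) ∧ l.prod = g) (i : σ) :
    IsSemilinearSet (D.weightedReps f S ω i) := by
  let N := Fin n → ℕ
  let πx : (N × N) × ℕ →+ N := (AddMonoidHom.fst N N).comp (AddMonoidHom.fst _ _)
  let πy : (N × N) × ℕ →+ N := (AddMonoidHom.snd N N).comp (AddMonoidHom.fst _ _)
  let πr : (N × N) × ℕ →+ ℕ := AddMonoidHom.snd _ _
  have hT (k : σ) := (((D.isSemilinearSet_isConj f i k).preimage (AddMonoidHom.fst (N × N) ℕ)).inter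
    ((D.isSemilinearSet_weight_le S ω hgen k).preimage ((f.comp πy).prod πr))).image (πx.prod πr)
  convert ((D.isSemilinearSet_minimalReps f i).preimage (AddMonoidHom.fst N ℕ)).inter
    (IsSemilinearSet.iUnion hT) using 1
  ext ⟨x, r⟩
  simp only [weightedReps, Set.mem_ofPred_eq, Set.mem_inter_iff, Set.mem_iUnion]
  refine and_congr Iff.rfl ⟨?_, ?_⟩
  · rintro ⟨g, hg, hr⟩
    obtain ⟨k, y, rfl⟩ := D.exists_elt_eq f hf g
    exact ⟨k, ((x, y), r), ⟨hg, hr⟩, rfl⟩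
  · rintro ⟨k, ⟨⟨x', y⟩, r'⟩, ⟨hg, hr⟩, h⟩
    obtain ⟨rfl, rfl⟩ := Prod.mk.inj h
    exact ⟨_, hg, hr⟩

end Representatives

end AbelianByFinite

/-- The conjugacy classes of `G` containing an element of weight at most `r`. -/
def conjClassesOfWeightLE {G : Type*} [Group G] (S : Finset G) (ω : G → ℕ) (r : ℕ) :
    Set (Set G) :=
  {C : Set G | (∃ g : G, C = {h : G | ∃ x : G, h = x * g * x⁻¹}) ∧
    ∃ h ∈ C, inducedWeight S ω h ≤ r}

theorem setOf_conj_eq_iff {G : Type*} [Group G] (g g' : G) :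
    {h : G | ∃ x : G, h = x * g * x⁻¹} = {h : G | ∃ x : G, h = x * g' * x⁻¹} ↔ IsConj g g' := by
  have key (a : G) : {h : G | ∃ x : G, h = x * a * x⁻¹} = {h | IsConj a h} := by
    ext h
    simp [isConj_iff, eq_comm]
  rw [key, key]
  constructor
  · intro h
    have : g' ∈ {h | IsConj g h} := h ▸ IsConj.refl g'
    exact this
  · intro h
    ext a
    exact ⟨fun ha => h.symm.trans ha, fun ha => h.trans ha⟩

theorem finite_setOf_inducedWeight_le {G : Type*} [Group G] {S : Finset G}
    (hgen : ∀ g : G, ∃ l : List G, (∀ s ∈ l, s ∈ S) ∧ l.prod = g) {ω : G → ℕ}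
    (hω : ∀ s ∈ S, 0 < ω s) (r : ℕ) : {g | inducedWeight S ω g ≤ r}.Finite := by
  refine ((List.finite_length_le S r).image fun l => (l.map Subtype.val).prod).subset ?_
  intro g hg
  obtain ⟨l, hl, rfl, hw⟩ := (inducedWeight_le_iff hgen ω g r).1 hg
  lift l to List S using hl
  refine ⟨l, ?_, rfl⟩
  refine le_trans ?_ hw
  rw [List.map_map]
  simpa using List.length_le_sum_of_one_le (l.map (ω ∘ Subtype.val)) (by
    intro i hi
    obtain ⟨s, _, rfl⟩ := List.mem_map.1 hi
    exact hω s s.2)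

theorem finite_conjClassesOfWeightLE {G : Type*} [Group G] {S : Finset G}
    (hgen : ∀ g : G, ∃ l : List G, (∀ s ∈ l, s ∈ S) ∧ l.prod = g) {ω : G → ℕ}
    (hω : ∀ s ∈ S, 0 < ω s) (r : ℕ) : (conjClassesOfWeightLE S ω r).Finite := by
  refine ((finite_setOf_inducedWeight_le hgen hω r).image
    fun g => {h : G | ∃ x : G, h = x * g * x⁻¹}).subset ?_
  rintro _ ⟨⟨g, rfl⟩, h, ⟨x, rfl⟩, hw⟩
  refine ⟨_, hw, (setOf_conj_eq_iff _ _).2 ?_⟩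
  exact (isConj_iff.2 ⟨x, rfl⟩ : IsConj g (x * g * x⁻¹)).symm

namespace AbelianByFinite

variable {G V σ : Type*} [Group G] [AddCommGroup V] [LinearOrder σ] (S : Finset G) (ω : G → ℕ)

theorem bijective_conjClass (D : AbelianByFinite G V σ) [Finite σ] {n : ℕ}
    (f : (Fin n → ℕ) →+ V) (hf : Function.Surjective f) (r : ℕ) :
    Function.Bijective (fun p : Σ i, {x | (x, r) ∈ D.weightedReps f S ω i} =>
      (⟨{h : G | ∃ x : G, h = x * D.elt f p.1 p.2 * x⁻¹}, ⟨_, rfl⟩, by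
        obtain ⟨g, hg, hr⟩ := p.2.2.2
        obtain ⟨x, hx⟩ := isConj_iff.1 hg
        exact ⟨g, ⟨x, hx.symm⟩, hr⟩⟩ : conjClassesOfWeightLE S ω r)) := by
  constructor
  · rintro ⟨i, x, hx⟩ ⟨k, y, hy⟩ h
    obtain ⟨rfl, rfl⟩ := D.eq_of_isConj_of_mem_minimalReps f hx.1 hy.1
      ((setOf_conj_eq_iff _ _).1 (congrArg Subtype.val h))
    rfl
  · rintro ⟨_, ⟨g, rfl⟩, _, ⟨x, rfl⟩, hr⟩
    obtain ⟨i, y, hy, hg⟩ := D.exists_mem_minimalReps f hf g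
    exact ⟨⟨i, y, hy, _, hg.symm.trans (isConj_iff.2 ⟨x, rfl⟩), hr⟩,
      Subtype.ext ((setOf_conj_eq_iff _ _).2 hg.symm)⟩

theorem isRationalSeries_ncard_conjClasses (D : AbelianByFinite G V σ) [Finite σ]
    [AddMonoid.FG V]
    (hgen : ∀ g : G, ∃ l : List G, (∀ s ∈ l, s ∈ S) ∧ l.prod = g) (hω : ∀ s ∈ S, 0 < ω s) :
    IsRationalSeries
      (PowerSeries.mk fun r => ((conjClassesOfWeightLE S ω r).ncard : ℚ)) := by
  obtain ⟨n, f, hf⟩ := AddSubmonoid.fg_iff_exists_fin_addMonoidHom.1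
    (AddMonoid.FG.fg_top (M := V))
  rw [AddMonoidHom.mrange_eq_top] at hf
  have hbij := D.bijective_conjClass S ω f hf
  have hfin (r : ℕ) (i : σ) : {x | (x, r) ∈ D.weightedReps f S ω i}.Finite := by
    have := (finite_conjClassesOfWeightLE hgen hω r).to_subtype
    have := Finite.of_injective _ (hbij r).1
    exact Set.finite_coe_iff.1 (Finite.of_injective
      (Sigma.mk (β := fun i => {x | (x, r) ∈ D.weightedReps f S ω i}) i) sigma_mk_injective)
  have hfib (i : σ) (r : ℕ) : D.weightedReps f S ω i ∩ AddMonoidHom.snd (Fin n → ℕ) ℕ ⁻¹' {r} =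
      (fun x => (x, r)) '' {x | (x, r) ∈ D.weightedReps f S ω i} := by
    ext ⟨x, s⟩
    constructor
    · rintro ⟨h, rfl⟩
      exact ⟨x, h, rfl⟩
    · rintro ⟨y, h, ⟨⟩⟩
      exact ⟨h, rfl⟩
  have := Fintype.ofFinite σ
  have hsum : PowerSeries.mk (fun r => ((conjClassesOfWeightLE S ω r).ncard : ℚ)) =
      ∑ i, fiberSeries (AddMonoidHom.snd (Fin n → ℕ) ℕ) (D.weightedReps f S ω i) := by
    ext r
    have : ∀ i, Finite {x | (x, r) ∈ D.weightedReps f S ω i} := fun i => hfin r i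
    rw [map_sum, PowerSeries.coeff_mk, ← Nat.card_coe_set_eq,
      ← Nat.card_congr (Equiv.ofBijective _ (hbij r)), Nat.card_sigma, Nat.cast_sum]
    refine Finset.sum_congr rfl fun i _ => ?_
    rw [fiberSeries, PowerSeries.coeff_mk, hfib,
      Set.ncard_image_of_injective _ fun x y h => (Prod.mk.inj h).1]
    rfl
  rw [hsum]
  refine .sum _ fun i _ => (D.isSemilinearSet_weightedReps f S ω hf hgen i).isRationalSeries ?_
  intro r
  rw [hfib]
  exact (hfin r i).image _

end AbelianByFinite

open scoped IsMulCommutative in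
theorem isRationalSeries_of_normal_of_isMulCommutative {G : Type*} [Group G] (A : Subgroup G)
    [A.Normal] [A.FiniteIndex] [IsMulCommutative A] {S : Finset G}
    (hgen : ∀ g : G, ∃ l : List G, (∀ s ∈ l, s ∈ S) ∧ l.prod = g) {ω : G → ℕ}
    (hω : ∀ s ∈ S, 0 < ω s) :
    IsRationalSeries
      (PowerSeries.mk fun r => ((conjClassesOfWeightLE S ω r).ncard : ℚ)) := by
  have : Group.FG G := ⟨⟨S, by
    rw [eq_top_iff]
    rintro g -
    obtain ⟨l, hl, rfl⟩ := hgen g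
    exact list_prod_mem fun s hs => Subgroup.subset_closure (hl s hs)⟩⟩
  have : AddMonoid.FG (Additive A) := inferInstance
  obtain ⟨m, ⟨ε⟩⟩ := Finite.exists_equiv_fin (G ⧸ A)
  exact (AbelianByFinite.ofSubgroup A ε.symm).isRationalSeries_ncard_conjClasses S ω hgen hω

/-- Let `G` be a finitely generated virtually abelian group and `S` a finite
monoid generating set with weight function `ω : S → ℕ₊`. Let `c r` be the number of
conjugacy classes of `G` containing an element of weight at most `r`. Then the conjugacy
growth series `∑ c(r) zʳ` is a rational power series. -/
theorem conjugacy_growth_series_rational {G : Type*} [Group G]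
    (hVA : ∃ A : Subgroup G, A.index ≠ 0 ∧ ∀ x ∈ A, ∀ y ∈ A, x * y = y * x)
    (S : Finset G) (hgen : ∀ g : G, ∃ l : List G, (∀ s ∈ l, s ∈ S) ∧ l.prod = g)
    (ω : G → ℕ) (hω : ∀ s ∈ S, 0 < ω s)
    (c : ℕ → ℕ)
    (hc : ∀ r : ℕ, c r = Set.ncard {C : Set G |
      (∃ g : G, C = {h : G | ∃ x : G, h = x * g * x⁻¹}) ∧
      ∃ h ∈ C, inducedWeight S ω h ≤ r}) :
    ∃ p q : Polynomial ℚ, q.coeff 0 ≠ 0 ∧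
      (q : PowerSeries ℚ) * PowerSeries.mk (fun r => (c r : ℚ)) = (p : PowerSeries ℚ) := by
  obtain ⟨A₀, hindex, hcomm⟩ := hVA
  have : A₀.FiniteIndex := ⟨hindex⟩
  let A := A₀.normalCore
  have : IsMulCommutative A := ⟨⟨fun x y => Subtype.ext
    (hcomm _ (A₀.normalCore_le x.2) _ (A₀.normalCore_le y.2))⟩⟩
  obtain rfl : c = fun r => (conjClassesOfWeightLE S ω r).ncard := funext hc
  exact isRationalSeries_of_normal_of_isMulCommutative A hgen hω
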